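/- arXiv:2203.01093 — 3 statements merged into one kernel-verified Lean document; each statement's English description precedes it below -/
import Mathlib

section
/- The function IG(a) = H(a) - 2a, where H(a) = -(1-2a)·log₂(1-2a) - 2a·log₂(a), is strictly monotonically increasing on the open interval (0, 1/4) and strictly monotonically decreasing on the open interval (1/4, 1/3). -/
/-- Shannon entropy (in bits) of the soft label `[1-2a, a, a]`. -/
noncomputable def H (a : ℝ) : ℝ :=
  -(1 - 2*a) * Real.logb 2 (1 - 2*a) - 2*a * Real.logb 2 a

/-- Expected information gain of an oracle query on the soft label `[1-2a, a, a]`. -/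
noncomputable def IG (a : ℝ) : ℝ := H a - 2*a

theorem IG_hasDerivAt (x : ℝ) (h0 : 0 < x) (h1 : x < 1/2) :
    HasDerivAt IG ((2 * Real.log (1 - 2*x) - 2 * Real.log (2*x)) / Real.log 2) x := by
  have hl : Real.log 2 ≠ 0 := (Real.log_pos (by norm_num)).ne'
  have hy : (1 - 2*x) ≠ 0 := by linarith
  have e : IG = fun a => (-((1 - 2*a) * Real.log (1 - 2*a)) - 2*(a * Real.log a)
      - 2*a*Real.log 2) / Real.log 2 := by
    funext a
    simp only [IG, H, Real.logb]
    field_simp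
  rw [e]
  have d1 : HasDerivAt (fun a : ℝ => 1 - 2*a) (-2) x := by
    simpa using ((hasDerivAt_id x).const_mul 2).const_sub 1
  have d2 := (Real.hasDerivAt_mul_log hy).comp x d1
  have d3 := (Real.hasDerivAt_mul_log h0.ne').const_mul 2
  have d4 := ((hasDerivAt_id x).const_mul 2).mul_const (Real.log 2)
  have d := ((d2.neg.sub d3).sub d4).div_const (Real.log 2)
  refine HasDerivAt.congr_deriv d ?_
  rw [Real.log_mul two_ne_zero h0.ne']
  ring

theorem IG_strictMonoOn_strictAntiOn :
    StrictMonoOn IG (Set.Ioo (0 : ℝ) (1/4)) ∧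
    StrictAntiOn IG (Set.Ioo (1/4 : ℝ) (1/3)) := by
  have hl : 0 < Real.log 2 := Real.log_pos (by norm_num)
  constructor
  · apply strictMonoOn_of_deriv_pos (convex_Ioo _ _)
    · intro x hx
      exact (IG_hasDerivAt x hx.1 (by linarith [hx.2])).continuousAt.continuousWithinAt
    · intro x hx
      rw [interior_Ioo] at hx
      obtain ⟨h0, h1⟩ := hx
      rw [(IG_hasDerivAt x h0 (by linarith)).deriv]
      have := Real.log_lt_log (show 0 < 2*x by linarith) (show 2*x < 1 - 2*x by linarith)
      exact div_pos (by linarith) hl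
  · apply strictAntiOn_of_deriv_neg (convex_Ioo _ _)
    · intro x hx
      exact (IG_hasDerivAt x (by linarith [hx.1]) (by linarith [hx.2])).continuousAt.continuousWithinAt
    · intro x hx
      rw [interior_Ioo] at hx
      obtain ⟨h0, h1⟩ := hx
      rw [(IG_hasDerivAt x (by linarith) (by linarith)).deriv]
      have := Real.log_lt_log (show 0 < 1-2*x by linarith) (show 1-2*x < 2*x by linarith)
      exact div_neg_of_neg_of_pos (by linarith) hl
end

section
/- There exist a₁, a₂ ∈ (0, 1/3) such that H(a₁) < H(a₂) while IG(a₁) > IG(a₂), where H(a) = -(1-2a)·log₂(1-2a) - 2a·log₂(a) and IG(a) = H(a) - 2a. In particular a₁ = 1/4 and a₂ = 3/10 witness this: the node with the highest entropy soft label is not necessarily the node that brings the highest expected information gain. -/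
lemma H_quarter : H (1/4) = 3/2 := by
  have h1 : Real.logb 2 (1/2 : ℝ) = -1 := by
    rw [one_div, Real.logb_inv, Real.logb_self_eq_one (by norm_num)]
  have h2 : Real.logb 2 (1/4 : ℝ) = -2 := by
    rw [show (1/4 : ℝ) = (1/2) * (1/2) by norm_num,
      Real.logb_mul (by norm_num) (by norm_num), h1]
    norm_num
  unfold H
  rw [show (1 - 2 * (1/4) : ℝ) = 1/2 by norm_num, h1, h2]
  norm_num

lemma H_three_tenths :
    H (3/10) = 1/5 + Real.logb 2 5 - 3/5 * Real.logb 2 3 := by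
  have h0 : Real.logb 2 (2 : ℝ) = 1 := Real.logb_self_eq_one (by norm_num)
  have h1 : Real.logb 2 (2/5 : ℝ) = 1 - Real.logb 2 5 := by
    rw [Real.logb_div (by norm_num) (by norm_num), h0]
  have h2 : Real.logb 2 (3/10 : ℝ) = Real.logb 2 3 - (1 + Real.logb 2 5) := by
    rw [Real.logb_div (by norm_num) (by norm_num), show (10 : ℝ) = 2 * 5 by norm_num,
      Real.logb_mul (by norm_num) (by norm_num), h0]
  unfold H
  rw [show (1 - 2 * (3/10) : ℝ) = 2/5 by norm_num, h1, h2]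
  ring

lemma log_lower : 13 + 6 * Real.logb 2 3 < 10 * Real.logb 2 5 := by
  have h0 : Real.logb 2 (2 : ℝ) = 1 := Real.logb_self_eq_one (by norm_num)
  have h : Real.logb 2 ((2:ℝ)^13 * 3^6) < Real.logb 2 ((5:ℝ)^10) :=
    Real.logb_lt_logb (by norm_num) (by norm_num) (by norm_num)
  rw [Real.logb_mul (by positivity) (by positivity), Real.logb_pow, Real.logb_pow,
    Real.logb_pow, h0] at h
  push_cast at h
  linarith

lemma log_upper : 5 * Real.logb 2 5 < 7 + 3 * Real.logb 2 3 := by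
  have h0 : Real.logb 2 (2 : ℝ) = 1 := Real.logb_self_eq_one (by norm_num)
  have h : Real.logb 2 ((5:ℝ)^5) < Real.logb 2 ((2:ℝ)^7 * 3^3) :=
    Real.logb_lt_logb (by norm_num) (by norm_num) (by norm_num)
  rw [Real.logb_mul (by positivity) (by positivity), Real.logb_pow, Real.logb_pow,
    Real.logb_pow, h0] at h
  push_cast at h
  linarith

theorem entropy_not_IG :
    (∃ a₁ ∈ Set.Ioo (0 : ℝ) (1/3), ∃ a₂ ∈ Set.Ioo (0 : ℝ) (1/3),
      H a₁ < H a₂ ∧ IG a₁ > IG a₂) ∧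
    (H (1/4) < H (3/10) ∧ IG (1/4) > IG (3/10)) := by
  have key : H (1/4) < H (3/10) ∧ IG (1/4) > IG (3/10) := by
    have hl := log_lower
    have hu := log_upper
    unfold IG
    rw [H_quarter, H_three_tenths]
    constructor <;> linarith
  exact ⟨⟨1/4, by constructor <;> norm_num, 3/10, by constructor <;> norm_num, key⟩, key⟩
end

section
/- For every a ∈ [0, 1/3], IG(a) ≤ IG(1/4) = 1, where IG(a) = H(a) - 2a and H(a) = -(1-2a)·log₂(1-2a) - 2a·log₂(a) (with the convention 0·log₂ 0 = 0 at the endpoint a = 0). That is, the expected information gain of the soft label [1-2a, a, a] is maximized at a = 1/4. -/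
theorem IG_le_max :
    (∀ a ∈ Set.Icc (0 : ℝ) (1/3), IG a ≤ IG (1/4)) ∧ IG (1/4) = 1 := by
  have key : ∀ a : ℝ, 0 ≤ a → IG a = Real.binEntropy (2*a) / Real.log 2 := by
    intro a ha
    have h2 : Real.log 2 ≠ 0 := (Real.log_pos (by norm_num)).ne'
    unfold IG H Real.binEntropy
    rcases ha.eq_or_lt with rfl | ha
    · simp
    · rw [Real.log_inv, Real.log_inv, Real.log_mul (by norm_num) ha.ne']
      simp only [Real.logb]
      field_simp
      ring
  have h2 : 0 < Real.log 2 := Real.log_pos (by norm_num)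
  have h1 : IG (1/4) = 1 := by
    rw [key _ (by norm_num), show (2 * (1/4) : ℝ) = 2⁻¹ by norm_num, Real.binEntropy_two_inv]
    exact div_self h2.ne'
  refine ⟨fun a ha => ?_, h1⟩
  rw [h1, key a ha.1, div_le_one h2]
  exact Real.binEntropy_le_log_two
end
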